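/- arXiv:1709.06732 — 3 statements merged into one kernel-verified Lean document; each statement's English description precedes it below -/
import Mathlib

section
/- Let E be the elliptic curve over ℚ with Weierstrass equation y² = x³ − 48, and let G = (4, 4) ∈ E(ℚ). For every integer n ≥ 1, write n = 3^m · ℓ with m ≥ 0 and 3 ∤ ℓ. Then the point n·G (n-fold sum of G in the group E(ℚ)) is not the point at infinity, and its x-coordinate x(n·G) satisfies |x(n·G)|₃ = 3^{2m}, i.e., the 3-adic valuation of x(n·G) equals −2m. -/
noncomputable section

/-- The elliptic curve `E : y² = x³ - 48` over `ℚ`. -/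
def W48 : WeierstrassCurve.Affine ℚ := { a₁ := 0, a₂ := 0, a₃ := 0, a₄ := 0, a₆ := -48 }

theorem W48_nonsingular_G : W48.Nonsingular 4 4 := by
  rw [WeierstrassCurve.Affine.nonsingular_iff, WeierstrassCurve.Affine.equation_iff]
  norm_num [W48]

/-- The point `G = (4, 4) ∈ E(ℚ)`. -/
def G48 : W48.Point := WeierstrassCurve.Affine.Point.some _ _ W48_nonsingular_G

/-- `(t, w) = (x / y, 1 / y)` are the coordinates of `P` in the affine chart around infinity, where
the curve becomes `w = t³ - 48 w³`. -/
def HasChart : W48.Point → ℚ → ℚ → Prop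
  | .zero, t, w => t = 0 ∧ w = 0
  | .some x y _, t, w => x * w = t ∧ y * w = 1

theorem W48_equation_iff (x y : ℚ) : W48.Equation x y ↔ y ^ 2 = x ^ 3 - 48 := by
  rw [WeierstrassCurve.Affine.equation_iff]
  simp [W48, sub_eq_add_neg]

theorem W48_negY (x y : ℚ) : W48.negY x y = -y := by
  simp [WeierstrassCurve.Affine.negY, W48]

theorem HasChart.equation {P : W48.Point} {t w : ℚ} (h : HasChart P t w) :
    w * (1 + 48 * w ^ 2) = t ^ 3 := by
  match P, h with
  | .zero, ⟨ht, hw⟩ => simp [ht, hw]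
  | .some x y hP, ⟨ht, hw⟩ =>
    have hE := (W48_equation_iff x y).1 hP.1
    subst ht
    linear_combination w ^ 3 * hE - (y * w ^ 2 + w) * hw

/-- The line through two affine points which are not opposite, written `w = a t + b` in the chart at
infinity, has `b ≠ 0` and affine slope `-a / b`. -/
theorem chart_line {x₁ y₁ x₂ y₂ t₁ w₁ t₂ w₂ a b : ℚ}
    (h₁ : y₁ ^ 2 = x₁ ^ 3 - 48) (h₂ : y₂ ^ 2 = x₂ ^ 3 - 48)
    (hxy : ¬(x₁ = x₂ ∧ y₁ = W48.negY x₂ y₂))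
    (ht₁ : x₁ * w₁ = t₁) (hw₁ : y₁ * w₁ = 1) (ht₂ : x₂ * w₂ = t₂) (hw₂ : y₂ * w₂ = 1)
    (ha : a * (1 + 48 * (w₁ ^ 2 + w₁ * w₂ + w₂ ^ 2)) = t₁ ^ 2 + t₁ * t₂ + t₂ ^ 2)
    (hb₁ : w₁ = a * t₁ + b) (hb₂ : w₂ = a * t₂ + b) :
    b ≠ 0 ∧ b * W48.slope x₁ x₂ y₁ y₂ = -a := by
  have hl₁ : a * x₁ + b * y₁ = 1 := by
    linear_combination (1 - a * x₁) * hw₁ - y₁ * hb₁ + a * y₁ * ht₁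
  have hl₂ : a * x₂ + b * y₂ = 1 := by
    linear_combination (1 - a * x₂) * hw₂ - y₂ * hb₂ + a * y₂ * ht₂
  by_cases hx : x₁ = x₂
  · have hy : y₁ ≠ W48.negY x₂ y₂ := fun h ↦ hxy ⟨hx, h⟩
    have hy' : y₁ = y₂ := by
      have : (y₁ - y₂) * (y₁ + y₂) = 0 := by subst hx; linear_combination h₁ - h₂
      rcases mul_eq_zero.1 this with h | h
      · linarith
      · exact absurd (by rw [W48_negY]; linarith) hy
    subst hx hy'
    have hw : w₁ = w₂ := by linear_combination w₂ * hw₁ - w₁ * hw₂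
    subst hw
    subst ht₁ ht₂
    have hy0 : y₁ ≠ 0 := left_ne_zero_of_mul_eq_one hw₁
    have ha' : a * (y₁ ^ 2 + 144) = 3 * x₁ ^ 2 := by
      have hw2 : y₁ ^ 2 * w₁ ^ 2 = 1 := by rw [← mul_pow, hw₁, one_pow]
      linear_combination y₁ ^ 2 * ha - (144 * a - 3 * x₁ ^ 2) * hw2
    refine ⟨?_, ?_⟩
    · rintro rfl
      have h0 : a * x₁ = 1 := by linarith
      have : y₁ ^ 2 = 0 := by
        linear_combination -(1 / 2) * (x₁ * ha' - (y₁ ^ 2 + 144) * h0) + 3 / 2 * h₁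
      exact hy0 (pow_eq_zero_iff two_ne_zero |>.1 this)
    · rw [WeierstrassCurve.Affine.slope_of_Y_ne rfl hy, W48_negY]
      simp only [W48]
      have : y₁ - -y₁ ≠ 0 := by
        intro h; apply hy0; linarith
      field_simp
      apply mul_left_cancel₀ hy0
      linear_combination 3 * x₁ ^ 2 * hl₁ + 3 * a * h₁ - ha'
  · refine ⟨?_, ?_⟩
    · rintro rfl
      have h0 : a ≠ 0 := by rintro rfl; simp at hl₁
      exact hx (mul_left_cancel₀ h0 (by linarith))
    · rw [WeierstrassCurve.Affine.slope_of_X_ne hx]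
      have := sub_ne_zero.2 hx
      field_simp
      linear_combination hl₁ - hl₂

/-- The third intersection point of the line `y = s x + b⁻¹`, which is `w = -b s t + b` in the chart
at infinity, in terms of the elementary symmetric functions of the three `x`-coordinates. -/
theorem chart_third_point {x₁ x₂ x₃ t₁ t₂ b c s d : ℚ} (hbc : b * c = 1)
    (he₁ : x₁ + x₂ + x₃ = s ^ 2) (he₂ : x₁ * x₂ + x₁ * x₃ + x₂ * x₃ = -2 * s * c)
    (he₃ : x₁ * x₂ * x₃ = c ^ 2 + 48)
    (ht₁ : t₁ * (1 + b * s * x₁) = b * x₁) (ht₂ : t₂ * (1 + b * s * x₂) = b * x₂)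
    (hd : d = 1 - 48 * (-(b * s)) ^ 3) (hd0 : d ≠ 0) :
    x₃ * (-(b * s) * (t₁ + t₂ - 144 * (-(b * s)) ^ 2 * b / d) - b) =
      t₁ + t₂ - 144 * (-(b * s)) ^ 2 * b / d := by
  have hprod : (1 + b * s * x₁) * (1 + b * s * x₂) * (1 + b * s * x₃) = d := by
    rw [hd]
    linear_combination b * s * he₁ + (b * s) ^ 2 * he₂ + (b * s) ^ 3 * he₃ +
      b * s ^ 3 * (b * c - 1) * hbc
  have hne : (1 + b * s * x₁) * (1 + b * s * x₂) ≠ 0 := by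
    intro h
    rw [h, zero_mul] at hprod
    exact hd0 hprod.symm
  obtain ⟨e, he⟩ : ∃ e, 144 * (-(b * s)) ^ 2 * b / d = e := ⟨_, rfl⟩
  have hed : e * d = 144 * (-(b * s)) ^ 2 * b := by
    rw [← he, div_mul_cancel₀ _ hd0]
  rw [he]
  apply mul_left_cancel₀ hne
  linear_combination -(1 + b * s * x₂) * (1 + b * s * x₃) * ht₁ -
    (1 + b * s * x₁) * (1 + b * s * x₃) * ht₂ + hed + e * hprod -
    b * (he₁ + 2 * b * s * he₂ + 3 * (b * s) ^ 2 * he₃ + s ^ 2 * (3 * b * c - 1) * hbc)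

/-- The elementary symmetric functions of the `x`-coordinates of three collinear points. -/
theorem W48_symm_addX {x₁ y₁ x₂ y₂ s : ℚ} (h₁ : W48.Equation x₁ y₁) (h₂ : W48.Equation x₂ y₂)
    (hxy : ¬(x₁ = x₂ ∧ y₁ = W48.negY x₂ y₂)) (hs : W48.slope x₁ x₂ y₁ y₂ = s) :
    x₁ + x₂ + W48.addX x₁ x₂ s = s ^ 2 ∧
    x₁ * x₂ + x₁ * W48.addX x₁ x₂ s + x₂ * W48.addX x₁ x₂ s = -2 * s * (y₁ - s * x₁) ∧
    x₁ * x₂ * W48.addX x₁ x₂ s = (y₁ - s * x₁) ^ 2 + 48 := by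
  have hpoly := WeierstrassCurve.Affine.addPolynomial_slope h₁ h₂ hxy
  rw [hs] at hpoly
  have hX : W48.addX x₁ x₂ s = s ^ 2 - x₁ - x₂ := by
    simp [WeierstrassCurve.Affine.addX, W48]
  generalize W48.addX x₁ x₂ s = x₃ at hpoly hX ⊢
  have hev (u : ℚ) : (s * (u - x₁) + y₁) ^ 2 - (u ^ 3 - 48) =
      -((u - x₁) * (u - x₂) * (u - x₃)) := by
    have := congrArg (Polynomial.eval u) hpoly
    rw [WeierstrassCurve.Affine.addPolynomial_eq] at this
    simp [W48, Cubic.toPoly] at this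
    linear_combination this
  have he₁ : x₁ + x₂ + x₃ = s ^ 2 := by linear_combination hX
  have he₃ : x₁ * x₂ * x₃ = (y₁ - s * x₁) ^ 2 + 48 := by linear_combination -hev 0
  exact ⟨he₁, by linear_combination hev 1 + he₁ + he₃, he₃⟩

/-- The addition law in the chart at infinity. -/
theorem hasChart_add_of_line {x₁ y₁ x₂ y₂ t₁ w₁ t₂ w₂ a b : ℚ}
    (h₁ : W48.Nonsingular x₁ y₁) (h₂ : W48.Nonsingular x₂ y₂)
    (hxy : ¬(x₁ = x₂ ∧ y₁ = W48.negY x₂ y₂))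
    (hc₁ : HasChart (.some _ _ h₁) t₁ w₁) (hc₂ : HasChart (.some _ _ h₂) t₂ w₂)
    (ha : a * (1 + 48 * (w₁ ^ 2 + w₁ * w₂ + w₂ ^ 2)) = t₁ ^ 2 + t₁ * t₂ + t₂ ^ 2)
    (hb₁ : w₁ = a * t₁ + b) (hb₂ : w₂ = a * t₂ + b) (hd : 1 - 48 * a ^ 3 ≠ 0) :
    HasChart (.some _ _ h₁ + .some _ _ h₂)
      (t₁ + t₂ - 144 * a ^ 2 * b / (1 - 48 * a ^ 3))
      (a * (t₁ + t₂ - 144 * a ^ 2 * b / (1 - 48 * a ^ 3)) - b) := by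
  obtain ⟨ht₁, hw₁⟩ := hc₁
  obtain ⟨ht₂, hw₂⟩ := hc₂
  obtain ⟨hb, hbs⟩ := chart_line ((W48_equation_iff _ _).1 h₁.1) ((W48_equation_iff _ _).1 h₂.1)
    hxy ht₁ hw₁ ht₂ hw₂ ha hb₁ hb₂
  rw [WeierstrassCurve.Affine.Point.add_some hxy]
  obtain ⟨s, hs⟩ : ∃ s, W48.slope x₁ x₂ y₁ y₂ = s := ⟨_, rfl⟩
  obtain ⟨he₁, he₂, he₃⟩ := W48_symm_addX h₁.1 h₂.1 hxy hs
  have hY : W48.addY x₁ x₂ y₁ s = -(s * (W48.addX x₁ x₂ s - x₁) + y₁) := by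
    rw [WeierstrassCurve.Affine.addY, W48_negY, WeierstrassCurve.Affine.negAddY]
  rw [hs] at hbs
  obtain rfl : a = -(b * s) := by linarith
  have hbc : b * (y₁ - s * x₁) = 1 := by
    linear_combination (1 + b * s * x₁) * hw₁ - y₁ * hb₁ - b * s * y₁ * ht₁
  have key := chart_third_point hbc he₁ he₂ he₃
    (t₁ := t₁) (t₂ := t₂) (by linear_combination x₁ * hb₁ - ht₁)
    (by linear_combination x₂ * hb₂ - ht₂) rfl hd
  subst hs
  refine ⟨key, ?_⟩
  rw [hY]
  generalize W48.slope x₁ x₂ y₁ y₂ = s at *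
  generalize t₁ + t₂ - 144 * (-(b * s)) ^ 2 * b / (1 - 48 * (-(b * s)) ^ 3) = t₃ at *
  apply mul_left_cancel₀ hb
  linear_combination (b * s * t₃ + b) * hbc - b * s * key

theorem padicNorm_add_le {a b r : ℚ} (ha : padicNorm 3 a ≤ r) (hb : padicNorm 3 b ≤ r) :
    padicNorm 3 (a + b) ≤ r :=
  padicNorm.nonarchimedean.trans (max_le ha hb)

theorem padicNorm_sub_le {a b r : ℚ} (ha : padicNorm 3 a ≤ r) (hb : padicNorm 3 b ≤ r) :
    padicNorm 3 (a - b) ≤ r :=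
  padicNorm.sub.trans (max_le ha hb)

theorem padicNorm_mul_le {a b r : ℚ} (ha : padicNorm 3 a ≤ r) (hb : padicNorm 3 b ≤ 1) :
    padicNorm 3 (a * b) ≤ r := by
  rw [padicNorm.mul]
  exact (mul_le_of_le_one_right (padicNorm.nonneg _) hb).trans ha

theorem padicNorm_eq_of_sub_lt {a b : ℚ} (h : padicNorm 3 (a - b) < padicNorm 3 b) :
    padicNorm 3 a = padicNorm 3 b := by
  rw [← sub_add_cancel a b, padicNorm.add_eq_max_of_ne h.ne, max_eq_right h.le]

theorem padicNorm_three : padicNorm 3 (3 : ℚ) = 1 / 3 := by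
  simpa using padicNorm.padicNorm_p (p := 3) (by norm_num)

theorem padicNorm_three_mul_lt_one {a : ℚ} (ha : padicNorm 3 a ≤ 1) :
    padicNorm 3 (3 * a) < 1 := by
  rw [padicNorm.mul, padicNorm_three]
  linarith

theorem padicNorm_one_add_three_mul {a : ℚ} (ha : padicNorm 3 a ≤ 1) :
    padicNorm 3 (1 + 3 * a) = 1 := by
  have := padicNorm_eq_of_sub_lt (a := 1 + 3 * a) (b := 1)
    (by simpa using padicNorm_three_mul_lt_one ha)
  simpa using this

theorem padicNorm_pow_le {a r : ℚ} (hr : r ≤ 1) (ha : padicNorm 3 a ≤ r) (n : ℕ) :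
    padicNorm 3 (a ^ (n + 1)) ≤ r := by
  induction n with
  | zero => simpa using ha
  | succ n ih =>
    rw [pow_succ]
    exact padicNorm_mul_le ih (ha.trans hr)

theorem padicNorm_int_mul_le {a r : ℚ} (k : ℤ) (ha : padicNorm 3 a ≤ r) :
    padicNorm 3 (k * a) ≤ r := by
  rw [mul_comm]
  exact padicNorm_mul_le ha (padicNorm.of_int k)

/-- `P` reduces to a nonsingular point modulo `3`, with coordinates `(t, w)` in the chart at
infinity. -/
structure HasIntegralChart (P : W48.Point) (t w : ℚ) : Prop where
  hasChart : HasChart P t w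
  norm_t_le : padicNorm 3 t ≤ 1
  norm_w_le : padicNorm 3 w ≤ 1

theorem HasIntegralChart.padicNorm_w {P : W48.Point} {t w : ℚ} (h : HasIntegralChart P t w) :
    padicNorm 3 w = padicNorm 3 t ^ 3 := by
  have hw : padicNorm 3 (1 + 3 * (((16 : ℤ) : ℚ) * w ^ 2)) = 1 :=
    padicNorm_one_add_three_mul (padicNorm_int_mul_le 16 (padicNorm_pow_le le_rfl h.norm_w_le 1))
  have he := congrArg (padicNorm 3) h.hasChart.equation
  have h48 : 1 + 48 * w ^ 2 = 1 + 3 * (((16 : ℤ) : ℚ) * w ^ 2) := by push_cast; ring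
  rw [h48, padicNorm.mul, hw, mul_one] at he
  rw [he, pow_three, pow_three, padicNorm.mul, padicNorm.mul]

theorem HasIntegralChart.padicNorm_w_le {P : W48.Point} {t w r : ℚ} (h : HasIntegralChart P t w)
    (ht : padicNorm 3 t ≤ r) : padicNorm 3 w ≤ r := by
  rw [h.padicNorm_w]
  exact (pow_le_of_le_one (padicNorm.nonneg _) h.norm_t_le three_ne_zero).trans ht

/-- Addition in the chart at infinity is addition of `t`-coordinates, up to an error divisible by
`9` times anything dividing both `t`-coordinates. -/
theorem exists_hasIntegralChart_add {P Q : W48.Point} {t₁ w₁ t₂ w₂ r : ℚ} (hr : r ≤ 1)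
    (hP : HasIntegralChart P t₁ w₁) (hQ : HasIntegralChart Q t₂ w₂)
    (h₁ : padicNorm 3 t₁ ≤ r) (h₂ : padicNorm 3 t₂ ≤ r) :
    ∃ t w, HasIntegralChart (P + Q) t w ∧ padicNorm 3 (t - (t₁ + t₂)) ≤ r / 9 := by
  have hr0 : 0 ≤ r := (padicNorm.nonneg _).trans h₁
  match P, Q, hP, hQ with
  | .zero, Q, hP, hQ =>
    obtain ⟨rfl, rfl⟩ := hP.hasChart
    refine ⟨t₂, w₂, ?_, by simpa using by positivity⟩
    rwa [← WeierstrassCurve.Affine.Point.zero_def, zero_add]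
  | P, .zero, hP, hQ =>
    obtain ⟨rfl, rfl⟩ := hQ.hasChart
    refine ⟨t₁, w₁, ?_, by simpa using by positivity⟩
    rwa [← WeierstrassCurve.Affine.Point.zero_def, add_zero]
  | .some x₁ y₁ hn₁, .some x₂ y₂ hn₂, hP, hQ =>
    have hw₁ := hP.padicNorm_w_le h₁
    have hw₂ := hQ.padicNorm_w_le h₂
    by_cases hxy : x₁ = x₂ ∧ y₁ = W48.negY x₂ y₂
    · refine ⟨0, 0, ⟨?_, by simp, by simp⟩, ?_⟩
      · rw [WeierstrassCurve.Affine.Point.add_of_Y_eq hxy.1 hxy.2]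
        exact ⟨rfl, rfl⟩
      · obtain ⟨rfl, hy⟩ := hxy
        rw [W48_negY] at hy
        obtain ⟨ht₁, hv₁⟩ := hP.hasChart
        obtain ⟨ht₂, hv₂⟩ := hQ.hasChart
        have hw : w₁ + w₂ = 0 := by
          linear_combination w₁ * w₂ * hy - w₂ * hv₁ - w₁ * hv₂
        have : t₁ + t₂ = 0 := by linear_combination x₁ * hw - ht₁ - ht₂
        simpa [this] using by positivity
    set u := w₁ ^ 2 + w₁ * w₂ + w₂ ^ 2
    have hu : padicNorm 3 u ≤ 1 :=
      padicNorm_add_le (padicNorm_add_le (padicNorm_pow_le le_rfl hP.norm_w_le 1)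
        (padicNorm_mul_le hP.norm_w_le hQ.norm_w_le)) (padicNorm_pow_le le_rfl hQ.norm_w_le 1)
    have hU : padicNorm 3 (1 + 48 * u) = 1 := by
      convert padicNorm_one_add_three_mul (padicNorm_int_mul_le 16 hu) using 2
      push_cast
      ring
    have hU0 : 1 + 48 * u ≠ 0 := by
      intro h
      simp [h] at hU
    obtain ⟨a, ha⟩ : ∃ a, a * (1 + 48 * u) = t₁ ^ 2 + t₁ * t₂ + t₂ ^ 2 :=
      ⟨_, div_mul_cancel₀ _ hU0⟩
    have har : padicNorm 3 a ≤ r := by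
      have := congrArg (padicNorm 3) ha
      rw [padicNorm.mul, hU, mul_one] at this
      rw [this]
      exact padicNorm_add_le (padicNorm_add_le (padicNorm_pow_le hr h₁ 1)
        (padicNorm_mul_le h₁ hQ.norm_t_le)) (padicNorm_pow_le hr h₂ 1)
    have ha1 := har.trans hr
    obtain ⟨b, hb⟩ : ∃ b, w₁ = a * t₁ + b := ⟨w₁ - a * t₁, by ring⟩
    have hb₂ : w₂ = a * t₂ + b := by
      apply mul_left_cancel₀ hU0
      linear_combination hQ.hasChart.equation - hP.hasChart.equation + (1 + 48 * u) * hb +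
        (t₁ - t₂) * ha
    have hbr : padicNorm 3 b ≤ r := by
      obtain rfl : b = w₁ - a * t₁ := by linear_combination -hb
      exact padicNorm_sub_le hw₁ (padicNorm_mul_le har hP.norm_t_le)
    have hD : padicNorm 3 (1 - 48 * a ^ 3) = 1 := by
      convert padicNorm_one_add_three_mul
        (padicNorm_int_mul_le (-16) (padicNorm_pow_le le_rfl ha1 2)) using 2
      push_cast
      ring
    have hD0 : 1 - 48 * a ^ 3 ≠ 0 := by
      intro h
      simp [h] at hD
    have hchart := hasChart_add_of_line hn₁ hn₂ hxy hP.hasChart hQ.hasChart ha hb hb₂ hD0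
    set t := t₁ + t₂ - 144 * a ^ 2 * b / (1 - 48 * a ^ 3) with ht
    have herr : padicNorm 3 (t - (t₁ + t₂)) ≤ r / 9 := by
      have : t - (t₁ + t₂) = 3 * (3 * ((-16 : ℤ) * (a ^ 2 * b) / (1 - 48 * a ^ 3))) := by
        rw [ht]
        push_cast
        ring
      rw [this, padicNorm.mul, padicNorm.mul, padicNorm_three, padicNorm.div, hD, div_one]
      have := padicNorm_int_mul_le (-16) (padicNorm_mul_le (padicNorm_pow_le hr har 1)
        (hbr.trans hr))
      norm_num at this ⊢
      linarith
    have ht1 : padicNorm 3 t ≤ 1 := by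
      rw [← sub_add_cancel t (t₁ + t₂)]
      exact padicNorm_add_le (by linarith) (padicNorm_add_le hP.norm_t_le hQ.norm_t_le)
    exact ⟨t, _, ⟨hchart, ht1, padicNorm_sub_le (padicNorm_mul_le ha1 ht1) (hbr.trans hr)⟩, herr⟩

/-- In the chart at infinity, `t (n • P)` agrees with `n * t P` modulo `9 * t P`. -/
theorem exists_hasIntegralChart_nsmul {P : W48.Point} {t w : ℚ} (hP : HasIntegralChart P t w)
    (n : ℕ) : ∃ t' w', HasIntegralChart (n • P) t' w' ∧
      padicNorm 3 (t' - n * t) ≤ padicNorm 3 t / 9 := by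
  have h0 := padicNorm.nonneg (p := 3) t
  induction n with
  | zero => exact ⟨0, 0, ⟨by rw [zero_nsmul]; exact ⟨rfl, rfl⟩, by simp, by simp⟩,
      by simpa using by positivity⟩
  | succ n ih =>
    obtain ⟨t₁, w₁, h, hn⟩ := ih
    have hnt : padicNorm 3 (n * t) ≤ padicNorm 3 t := by
      exact_mod_cast padicNorm_int_mul_le n le_rfl
    have ht₁ : padicNorm 3 t₁ ≤ padicNorm 3 t := by
      rw [← sub_add_cancel t₁ (n * t)]
      exact padicNorm_add_le (by linarith) hnt
    obtain ⟨t₂, w₂, h', hn'⟩ := exists_hasIntegralChart_add hP.norm_t_le h hP ht₁ le_rfl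
    refine ⟨t₂, w₂, by rwa [succ_nsmul], ?_⟩
    have : t₂ - (n + 1 : ℕ) * t = (t₂ - (t₁ + t)) + (t₁ - n * t) := by
      push_cast
      ring
    rw [this]
    exact padicNorm_add_le hn' hn

/-- If `9 ∤ n`, then `t (n • P)` has the same `3`-adic norm as `n * t P`. -/
theorem exists_hasIntegralChart_nsmul_norm_eq {P : W48.Point} {t w : ℚ}
    (hP : HasIntegralChart P t w) (ht : t ≠ 0) {n : ℕ} (hn : 1 / 9 < padicNorm 3 (n : ℚ)) :
    ∃ t' w', HasIntegralChart (n • P) t' w' ∧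
      padicNorm 3 t' = padicNorm 3 (n : ℚ) * padicNorm 3 t := by
  obtain ⟨t', w', h, hle⟩ := exists_hasIntegralChart_nsmul hP n
  refine ⟨t', w', h, ?_⟩
  have hpos : 0 < padicNorm 3 t := (padicNorm.nonneg _).lt_of_ne' (padicNorm.nonzero ht)
  rw [← padicNorm.mul]
  apply padicNorm_eq_of_sub_lt
  rw [padicNorm.mul]
  nlinarith

theorem exists_hasIntegralChart_three_pow_nsmul {P : W48.Point} {t w : ℚ}
    (hP : HasIntegralChart P t w) (ht : padicNorm 3 t = 1) (m : ℕ) :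
    ∃ t' w', HasIntegralChart (3 ^ m • P) t' w' ∧ padicNorm 3 t' = (1 / 3) ^ m := by
  induction m with
  | zero => exact ⟨t, w, by simpa using hP, by simpa using ht⟩
  | succ m ih =>
    obtain ⟨t₁, w₁, h₁, hn₁⟩ := ih
    have ht₁ : t₁ ≠ 0 := by
      rintro rfl
      rw [padicNorm.zero] at hn₁
      exact pow_ne_zero m (by norm_num) hn₁.symm
    have h3 : padicNorm 3 ((3 : ℕ) : ℚ) = 1 / 3 := by exact_mod_cast padicNorm_three
    obtain ⟨t₂, w₂, h₂, hn₂⟩ := exists_hasIntegralChart_nsmul_norm_eq h₁ ht₁ (n := 3)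
      (by rw [h3]; norm_num)
    refine ⟨t₂, w₂, by rwa [pow_succ', mul_smul], ?_⟩
    rw [hn₂, h3, hn₁, pow_succ']

theorem HasIntegralChart.exists_eq_some {P : W48.Point} {t w : ℚ} (hP : HasIntegralChart P t w)
    (ht : t ≠ 0) : ∃ (x y : ℚ) (h : W48.Nonsingular x y),
      P = .some _ _ h ∧ padicNorm 3 x = (padicNorm 3 t ^ 2)⁻¹ := by
  match P, hP with
  | .zero, hP => exact absurd hP.hasChart.1 ht
  | .some x y h, hP =>
    refine ⟨x, y, h, rfl, ?_⟩
    have ht0 := padicNorm.nonzero (p := 3) ht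
    have := congrArg (padicNorm 3) hP.hasChart.1
    rw [padicNorm.mul, hP.padicNorm_w] at this
    rw [← mul_eq_one_iff_eq_inv₀ (pow_ne_zero 2 ht0)]
    apply mul_right_cancel₀ ht0
    linear_combination this

theorem hasIntegralChart_G48 : HasIntegralChart G48 1 (1 / 4) := by
  have h4 : padicNorm 3 (4 : ℚ) = 1 := by
    exact_mod_cast (padicNorm.nat_eq_one_iff (p := 3) 4).2 (by norm_num)
  refine ⟨⟨by norm_num, by norm_num⟩, by simp, ?_⟩
  rw [padicNorm.div, h4]
  simp


/-- **Proposition 3.5 (`prop:bound N`):** for `n = 3^m · ℓ` with `3 ∤ ℓ`, the point `n • G`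
on `y² = x³ - 48` is affine and its `x`-coordinate satisfies `|x(n • G)|₃ = 3^{2m}`. -/
theorem padicNorm_x_of_nsmul_G (n m ℓ : ℕ) (hn : 1 ≤ n) (hfact : n = 3 ^ m * ℓ)
    (hℓ : ¬ 3 ∣ ℓ) :
    ∃ (x y : ℚ) (h : W48.Nonsingular x y),
      n • G48 = WeierstrassCurve.Affine.Point.some _ _ h ∧
      padicNorm 3 x = 3 ^ (2 * m) := by
  have hG : padicNorm 3 (1 : ℚ) = 1 := padicNorm.one
  have hl : padicNorm 3 (ℓ : ℚ) = 1 := (padicNorm.nat_eq_one_iff ℓ).2 hℓ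
  obtain ⟨t₁, w₁, h₁, hn₁⟩ := exists_hasIntegralChart_three_pow_nsmul hasIntegralChart_G48 hG m
  have ht₁ : t₁ ≠ 0 := by
    rintro rfl
    rw [padicNorm.zero] at hn₁
    exact pow_ne_zero m (by norm_num) hn₁.symm
  obtain ⟨t₂, w₂, h₂, hn₂⟩ := exists_hasIntegralChart_nsmul_norm_eq h₁ ht₁ (n := ℓ)
    (by rw [hl]; norm_num)
  rw [hl, one_mul, hn₁] at hn₂
  have ht₂ : t₂ ≠ 0 := by
    rintro rfl
    rw [padicNorm.zero] at hn₂
    exact pow_ne_zero m (by norm_num) hn₂.symm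
  obtain ⟨x, y, h, hP, hx⟩ := h₂.exists_eq_some ht₂
  refine ⟨x, y, h, by rw [← hP, hfact, mul_comm, mul_smul], ?_⟩
  rw [hx, hn₂, ← pow_mul, mul_comm m 2, one_div, inv_pow, inv_inv]

end
end

section
/- Let E be the elliptic curve over ℚ with Weierstrass equation y² = x³ − 48, and let G = (4, 4) ∈ E(ℚ), so that 3·G = (73/9, 595/27). If P = (x_P, y_P) ∈ E(ℚ) is an affine rational point with |x_P|₃ = 1 (i.e., v₃(x_P) = 0), then P + 3·G is an affine point and its x-coordinate satisfies |x(P + 3·G)|₃ = 1. -/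
noncomputable section

theorem W48_nonsingular_two_smul_G : W48.Nonsingular 28 (-148) := by
  rw [WeierstrassCurve.Affine.nonsingular_iff, WeierstrassCurve.Affine.equation_iff]
  norm_num [W48]

theorem W48_nonsingular_three_smul_G : W48.Nonsingular (73 / 9) (595 / 27) := by
  rw [WeierstrassCurve.Affine.nonsingular_iff, WeierstrassCurve.Affine.equation_iff]
  norm_num [W48]

theorem two_smul_G48 :
    2 • G48 = WeierstrassCurve.Affine.Point.some _ _ W48_nonsingular_two_smul_G := by
  have hy : (4 : ℚ) ≠ W48.negY 4 4 := by norm_num [WeierstrassCurve.Affine.negY, W48]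
  rw [two_smul, G48, WeierstrassCurve.Affine.Point.add_self_of_Y_ne hy]
  simp only [WeierstrassCurve.Affine.Point.some.injEq,
    WeierstrassCurve.Affine.slope_of_Y_ne rfl hy]
  norm_num [WeierstrassCurve.Affine.addX, WeierstrassCurve.Affine.addY,
    WeierstrassCurve.Affine.negAddY, WeierstrassCurve.Affine.negY, W48]

theorem three_smul_G48 :
    3 • G48 = WeierstrassCurve.Affine.Point.some _ _ W48_nonsingular_three_smul_G := by
  have hx : (28 : ℚ) ≠ 4 := by norm_num
  rw [succ_nsmul, two_smul_G48, G48, WeierstrassCurve.Affine.Point.add_of_X_ne hx]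
  simp only [WeierstrassCurve.Affine.Point.some.injEq, WeierstrassCurve.Affine.slope_of_X_ne hx]
  norm_num [WeierstrassCurve.Affine.addX, WeierstrassCurve.Affine.addY,
    WeierstrassCurve.Affine.negAddY, WeierstrassCurve.Affine.negY, W48]

theorem padicNorm_add_eq_one {p : ℕ} [Fact p.Prime] {a b : ℚ} (ha : padicNorm p a = 1)
    (hb : padicNorm p b < 1) : padicNorm p (a + b) = 1 := by
  rw [padicNorm.add_eq_max_of_ne (by rw [ha]; exact hb.ne'), ha, max_eq_left hb.le]

theorem padicNorm_intCast_mul_le_one {p : ℕ} [Fact p.Prime] (m : ℤ) {a : ℚ}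
    (ha : padicNorm p a ≤ 1) : padicNorm p (m * a) ≤ 1 := by
  rw [padicNorm.mul]
  exact mul_le_one₀ (padicNorm.of_int m) (padicNorm.nonneg _) ha

/-- **Claim 1 in the proof of Proposition 3.5:** if `P = (x_P, y_P)` is an affine rational
point on `y² = x³ - 48` with `|x_P|₃ = 1`, then `P + 3 • G` is affine and its
`x`-coordinate satisfies `|x(P + 3 • G)|₃ = 1`. -/
theorem padicNorm_x_of_add_three_smul_G
    (xP yP : ℚ) (hP : W48.Nonsingular xP yP) (hxP : padicNorm 3 xP = 1) :
    ∃ (x y : ℚ) (h : W48.Nonsingular x y),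
      WeierstrassCurve.Affine.Point.some _ _ hP + 3 • G48 =
        WeierstrassCurve.Affine.Point.some _ _ h ∧
      padicNorm 3 x = 1 := by
  have heq : yP ^ 2 = xP ^ 3 - 48 := by
    have := (WeierstrassCurve.Affine.equation_iff _ _).1 hP.1
    simp only [W48] at this
    linarith
  have hy : padicNorm 3 yP ≤ 1 := by
    have h : padicNorm 3 (yP ^ 2) ≤ 1 := by
      rw [heq]
      refine padicNorm.sub.trans (max_le ?_ (padicNorm.of_nat 48))
      rw [show xP ^ 3 = xP * xP * xP by ring]
      simp [padicNorm.mul, hxP]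
    rw [sq, padicNorm.mul, ← sq] at h
    exact (sq_le_one_iff₀ (padicNorm.nonneg _)).1 h
  have hden : padicNorm 3 (9 * xP - 73) = 1 := by
    rw [show 9 * xP - 73 = -1 + 3 * ((3 : ℤ) * xP + ((-24 : ℤ) : ℚ)) by push_cast; ring]
    refine padicNorm_add_eq_one (by simp) (padicNorm_three_mul_lt_one ?_)
    exact padicNorm.nonarchimedean.trans
      (max_le (padicNorm_intCast_mul_le_one _ hxP.le) (padicNorm.of_int _))
  have hden0 : 9 * xP - 73 ≠ 0 := by
    intro h
    simp [h] at hden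
  have hnum : padicNorm 3 (73 * xP * (9 * xP + 73) - 7776 - 3570 * yP) = 1 := by
    rw [show 73 * xP * (9 * xP + 73) - 7776 - 3570 * yP = xP +
      3 * ((219 : ℤ) * (xP * xP) + ((1776 : ℤ) * xP + (((-2592 : ℤ) : ℚ) + (-1190 : ℤ) * yP)))
      by push_cast; ring]
    refine padicNorm_add_eq_one hxP (padicNorm_three_mul_lt_one ?_)
    refine padicNorm.nonarchimedean.trans (max_le (padicNorm_intCast_mul_le_one _ ?_) ?_)
    · simp [padicNorm.mul, hxP]
    refine padicNorm.nonarchimedean.trans (max_le (padicNorm_intCast_mul_le_one _ hxP.le) ?_)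
    exact padicNorm.nonarchimedean.trans
      (max_le (padicNorm.of_int _) (padicNorm_intCast_mul_le_one _ hy))
  have hx : xP ≠ 73 / 9 := by
    rintro rfl
    norm_num at hden0
  refine ⟨_, _, _, by rw [three_smul_G48, WeierstrassCurve.Affine.Point.add_of_X_ne hx], ?_⟩
  have hX : W48.addX xP (73 / 9) (W48.slope xP (73 / 9) yP (595 / 27)) =
      (73 * xP * (9 * xP + 73) - 7776 - 3570 * yP) / ((9 * xP - 73) * (9 * xP - 73)) := by
    rw [WeierstrassCurve.Affine.slope_of_X_ne hx]
    simp only [WeierstrassCurve.Affine.addX, W48]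
    rw [show xP - 73 / 9 = (9 * xP - 73) / 9 by ring]
    field_simp
    linear_combination 531441 * heq
  rw [hX, padicNorm.div, padicNorm.mul, hnum, hden]
  norm_num

end
end

section
/- Let E be the elliptic curve over ℚ with Weierstrass equation y² = x³ − 48. If P = (x_P, y_P) ∈ E(ℚ) is an affine rational point with |x_P|₃ ≥ 1 (i.e., v₃(x_P) ≤ 0), then 3·P is an affine point and its x-coordinate satisfies |x(3·P)|₃ = 9·|x_P|₃, i.e., v₃(x(3·P)) = v₃(x_P) − 2. -/
noncomputable section

/-- Adding a multiple of `p` does not change the `p`-adic norm of a rational of norm `≥ 1`. -/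
lemma padicNorm_add_int_of_dvd {p : ℕ} [Fact p.Prime] {s : ℚ} {n : ℤ} (hs : 1 ≤ padicNorm p s)
    (hn : (p : ℤ) ∣ n) : padicNorm p (s + n) = padicNorm p s := by
  have hlt : padicNorm p (n : ℚ) < padicNorm p s :=
    ((padicNorm.int_lt_one_iff n).2 hn).trans_le hs
  rw [padicNorm.add_eq_max_of_ne hlt.ne', max_eq_left hlt.le]

lemma padicNorm_pow (p : ℕ) [Fact p.Prime] (x : ℚ) (n : ℕ) :
    padicNorm p (x ^ n) = padicNorm p x ^ n := by
  induction n with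
  | zero => simp
  | succ n ih => rw [pow_succ, padicNorm.mul, ih, pow_succ]

lemma ne_zero_of_one_le_padicNorm {p : ℕ} {x : ℚ} (hx : 1 ≤ padicNorm p x) : x ≠ 0 := by
  rintro rfl
  norm_num at hx

namespace W48

open WeierstrassCurve.Affine

lemma equation_iff (x y : ℚ) : W48.Equation x y ↔ y ^ 2 = x ^ 3 - 48 := by
  rw [WeierstrassCurve.Affine.equation_iff]
  simp [W48, sub_eq_add_neg]

lemma negY_eq (x y : ℚ) : W48.negY x y = -y := by
  simp [negY, W48]

lemma addX_eq (x₁ x₂ ℓ : ℚ) : W48.addX x₁ x₂ ℓ = ℓ ^ 2 - x₁ - x₂ := by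
  simp [addX, W48]

lemma addY_eq (x₁ x₂ y ℓ : ℚ) :
    W48.addY x₁ x₂ y ℓ = -(ℓ * (ℓ ^ 2 - x₁ - x₂ - x₁) + y) := by
  rw [addY, negAddY, negY_eq, addX_eq]

lemma slope_self {x y : ℚ} (hy : y ≠ 0) : W48.slope x x y y = 3 * x ^ 2 / (2 * y) := by
  rw [slope_of_Y_ne rfl (by rw [negY_eq]; exact fun h ↦ hy (by linarith)), negY_eq]
  simp [W48]
  ring

/-- The addition law gives the point `2 • (x, y)` explicitly. -/
lemma exists_add_self {x y : ℚ} (h : W48.Nonsingular x y) (hy : y ≠ 0) :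
    ∃ (x₂ y₂ : ℚ) (h₂ : W48.Nonsingular x₂ y₂),
      Point.some x y h + Point.some x y h = Point.some x₂ y₂ h₂ ∧
      x₂ - x = 3 * x * (192 - x ^ 3) / (4 * y ^ 2) ∧
      y₂ = -(3 * x ^ 2 / (2 * y) * (x₂ - x) + y) := by
  have hne : y ≠ W48.negY x y := by
    rw [negY_eq]
    exact fun h ↦ hy (by linarith)
  have heq := (equation_iff x y).1 h.1
  refine ⟨_, _, _, Point.add_self_of_Y_ne hne, ?_, ?_⟩
  · rw [slope_self hy, addX_eq]
    field_simp
    rw [heq]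
    ring
  · rw [slope_self hy, addX_eq, addY_eq]

/-- The triplication formula on the `x`-coordinate. -/
lemma exists_three_smul {x y : ℚ} (h : W48.Nonsingular x y) (hx : x ≠ 0) (hy : y ≠ 0)
    (hx' : 192 - x ^ 3 ≠ 0) :
    ∃ (x₃ y₃ : ℚ) (h₃ : W48.Nonsingular x₃ y₃),
      3 • Point.some x y h = Point.some x₃ y₃ h₃ ∧
      x₃ = (x ^ 9 + 4608 * x ^ 6 + 110592 * x ^ 3 - 7077888) / (3 * x * (192 - x ^ 3)) ^ 2 := by
  obtain ⟨x₂, y₂, h₂, hadd, hxx, hyy⟩ := exists_add_self h hy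
  have heq := (equation_iff x y).1 h.1
  have hsub : x₂ - x ≠ 0 := by
    rw [hxx]
    positivity
  have hne : x₂ ≠ x := sub_ne_zero.1 hsub
  refine ⟨_, _, _, by rw [succ_nsmul, two_nsmul, hadd, Point.add_of_X_ne hne], ?_⟩
  have hslope : W48.slope x₂ x y₂ y =
      -(3 * x ^ 2 / (2 * y)) - 8 * y ^ 3 / (3 * x * (192 - x ^ 3)) := by
    rw [slope_of_X_ne hne, hyy, div_eq_iff hsub, hxx]
    field_simp
    ring
  have hx₂ : x₂ = x + 3 * x * (192 - x ^ 3) / (4 * y ^ 2) := by linarith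
  have hx₃ : W48.addX x₂ x (W48.slope x₂ x y₂ y) =
      (x * (3 * x * (192 - x ^ 3)) ^ 2 + 24 * x ^ 2 * y ^ 2 * (3 * x * (192 - x ^ 3)) +
        64 * (y ^ 2) ^ 3) / (3 * x * (192 - x ^ 3)) ^ 2 := by
    have hm : (3 * x ^ 2 / (2 * y)) ^ 2 = 3 * x + 3 * x * (192 - x ^ 3) / (4 * y ^ 2) := by
      field_simp
      rw [heq]
      ring
    have hsq : W48.slope x₂ x y₂ y ^ 2 = (3 * x ^ 2 / (2 * y)) ^ 2 +
        24 * x ^ 2 * y ^ 2 / (3 * x * (192 - x ^ 3)) +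
        64 * y ^ 6 / (3 * x * (192 - x ^ 3)) ^ 2 := by
      rw [hslope]
      field_simp
      ring
    rw [addX_eq, hsq, hm, hx₂]
    field_simp
    ring
  rw [hx₃, heq]
  ring

end W48

/-- **Claim 2 in the proof of Proposition 3.5:** if `P = (x_P, y_P)` is an affine rational
point on `y² = x³ - 48` with `|x_P|₃ ≥ 1`, then `3 • P` is affine and its `x`-coordinate
satisfies `|x(3 • P)|₃ = 9 · |x_P|₃`. -/
theorem padicNorm_x_of_three_smul
    (xP yP : ℚ) (hP : W48.Nonsingular xP yP) (hxP : 1 ≤ padicNorm 3 xP) :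
    ∃ (x y : ℚ) (h : W48.Nonsingular x y),
      3 • (WeierstrassCurve.Affine.Point.some xP yP hP) =
        WeierstrassCurve.Affine.Point.some x y h ∧
      padicNorm 3 x = 9 * padicNorm 3 xP := by
  have hx : xP ≠ 0 := ne_zero_of_one_le_padicNorm hxP
  have heq := (W48.equation_iff xP yP).1 hP.1
  have ht : 1 ≤ padicNorm 3 (xP ^ 3) := by
    rw [padicNorm_pow]
    exact one_le_pow₀ hxP
  have h48 : padicNorm 3 (xP ^ 3 + (-48 : ℤ)) = padicNorm 3 (xP ^ 3) :=
    padicNorm_add_int_of_dvd ht (by norm_num)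
  have h192 : padicNorm 3 (xP ^ 3 + (-192 : ℤ)) = padicNorm 3 (xP ^ 3) :=
    padicNorm_add_int_of_dvd ht (by norm_num)
  have hy : yP ≠ 0 := by
    rintro rfl
    refine ne_zero_of_one_le_padicNorm (h48 ▸ ht) ?_
    push_cast
    linarith
  have hx' : 192 - xP ^ 3 ≠ 0 := by
    intro h0
    refine ne_zero_of_one_le_padicNorm (h192 ▸ ht) ?_
    push_cast
    linarith
  obtain ⟨x, y, h, hsmul, rfl⟩ := W48.exists_three_smul hP hx hy hx'
  refine ⟨_, y, h, hsmul, ?_⟩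
  have hnum : padicNorm 3 (xP ^ 9 + 4608 * xP ^ 6 + 110592 * xP ^ 3 - 7077888) =
      padicNorm 3 xP ^ 9 := by
    have h₁ : padicNorm 3 (xP ^ 3 + (4608 : ℤ)) = padicNorm 3 (xP ^ 3) :=
      padicNorm_add_int_of_dvd ht (by norm_num)
    have h₂ : padicNorm 3 ((xP ^ 3 + (4608 : ℤ)) * xP ^ 3 + (110592 : ℤ)) =
        padicNorm 3 (xP ^ 3) ^ 2 := by
      rw [padicNorm_add_int_of_dvd _ (by norm_num), padicNorm.mul, h₁, sq]
      rw [padicNorm.mul, h₁]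
      exact one_le_mul_of_one_le_of_one_le ht ht
    have h₃ : padicNorm 3 (((xP ^ 3 + (4608 : ℤ)) * xP ^ 3 + (110592 : ℤ)) * xP ^ 3 +
        (-7077888 : ℤ)) = padicNorm 3 (xP ^ 3) ^ 3 := by
      rw [padicNorm_add_int_of_dvd _ (by norm_num), padicNorm.mul, h₂, ← pow_succ]
      rw [padicNorm.mul, h₂]
      exact one_le_mul_of_one_le_of_one_le (one_le_pow₀ ht) ht
    rw [padicNorm_pow, ← pow_mul] at h₃
    rw [← h₃]
    push_cast
    ring_nf
  have hden : padicNorm 3 (192 - xP ^ 3) = padicNorm 3 xP ^ 3 := by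
    rw [← padicNorm_pow, ← h192, ← padicNorm.neg]
    push_cast
    ring_nf
  have h3 : padicNorm 3 (3 : ℚ) = 3⁻¹ := by
    simpa using padicNorm.padicNorm_p_of_prime (p := 3)
  have hpos : padicNorm 3 xP ≠ 0 := by positivity
  rw [padicNorm.div, padicNorm_pow, padicNorm.mul, padicNorm.mul, hnum, hden, h3]
  field_simp
  norm_num

end
end
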